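/- arXiv:1303.2159 — 7 statements merged into one kernel-verified Lean document; each statement's English description precedes it below -/
import Mathlib

section
/- Let Ω ⊆ ℝⁿ be an open set and let Φ = φ + iψ with φ, ψ : Ω → ℝ twice continuously differentiable, and suppose Φ solves the Eikonal equation on Ω (i.e. ∑_{j=1}^n (∂Φ/∂x_j)² = 0 on Ω). Then at every point x ∈ Ω one has ⟨H_φ(x) ∇ψ(x), ∇ψ(x)⟩ + ⟨H_φ(x) ∇φ(x), ∇φ(x)⟩ = 0. (Consequently the real part of a solution of the Eikonal equation is only weakly pseudoconvex: the Hörmander pseudoconvexity quantity vanishes identically in the characteristic directions ξ = τ∇ψ.) -/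
lemma aux_diff {n : ℕ} {f : (Fin n → ℝ) → ℝ} {x : Fin n → ℝ} (hf : ContDiffAt ℝ 2 f x) :
    DifferentiableAt ℝ (fderiv ℝ f) x :=
  (hf.fderiv_right (m := 1) (by norm_num)).differentiableAt (by norm_num)

lemma aux_diff' {n : ℕ} {f : (Fin n → ℝ) → ℝ} {x : Fin n → ℝ} (hf : ContDiffAt ℝ 2 f x)
    (v : Fin n → ℝ) : DifferentiableAt ℝ (fun y => fderiv ℝ f y v) x :=
  (aux_diff hf).clm_apply (differentiableAt_const v)

lemma aux_symm {n : ℕ} {f : (Fin n → ℝ) → ℝ} {x : Fin n → ℝ} (hf : ContDiffAt ℝ 2 f x)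
    (v w : Fin n → ℝ) :
    fderiv ℝ (fun y => fderiv ℝ f y v) x w = fderiv ℝ (fun y => fderiv ℝ f y w) x v := by
  have key : ∀ v w : Fin n → ℝ,
      fderiv ℝ (fun y => fderiv ℝ f y v) x w = fderiv ℝ (fderiv ℝ f) x w v := by
    intro v w
    rw [fderiv_clm_apply (aux_diff hf) (differentiableAt_const v)]
    simp
  rw [key, key]
  exact (hf.isSymmSndFDerivAt (by simp)) w v

lemma aux_prod {n : ℕ} {f g : (Fin n → ℝ) → ℝ} {x : Fin n → ℝ} (hf : ContDiffAt ℝ 2 f x)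
    (hg : ContDiffAt ℝ 2 g x) (v : Fin n → ℝ) :
    fderiv ℝ (fun y => ∑ j : Fin n,
      fderiv ℝ f y (Pi.single j 1) * fderiv ℝ g y (Pi.single j 1)) x v =
    ∑ j : Fin n, (fderiv ℝ f x (Pi.single j 1) *
        fderiv ℝ (fun y => fderiv ℝ g y (Pi.single j 1)) x v +
      fderiv ℝ g x (Pi.single j 1) *
        fderiv ℝ (fun y => fderiv ℝ f y (Pi.single j 1)) x v) := by
  rw [fderiv_fun_sum (fun j _ => (aux_diff' hf _).fun_mul (aux_diff' hg _))]
  rw [ContinuousLinearMap.sum_apply]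
  refine Finset.sum_congr rfl fun j _ => ?_
  rw [fderiv_fun_mul (aux_diff' hf _) (aux_diff' hg _)]
  simp

/-- Let `Ω ⊆ ℝⁿ` be open, `Φ = φ + iψ` with `φ, ψ : Ω → ℝ` of class `C²`,
and suppose `Φ` solves the Eikonal equation `∑_j (∂Φ/∂x_j)² = 0` on `Ω`. Then at every
`x ∈ Ω` one has `⟨H_φ ∇ψ, ∇ψ⟩ + ⟨H_φ ∇φ, ∇φ⟩ = 0`, where `H_φ` is the Hessian of `φ`. -/
theorem stmt_2 {n : ℕ} (Ω : Set (Fin n → ℝ)) (hΩ : IsOpen Ω)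
    (φ ψ : (Fin n → ℝ) → ℝ)
    (hφ : ContDiffOn ℝ 2 φ Ω) (hψ : ContDiffOn ℝ 2 ψ Ω)
    (heik : ∀ x ∈ Ω, ∑ j : Fin n,
        (fderiv ℝ (fun y => (φ y : ℂ) + Complex.I * (ψ y : ℂ)) x (Pi.single j 1)) ^ 2 = 0) :
    ∀ x ∈ Ω,
      (∑ i : Fin n, ∑ j : Fin n,
          (fderiv ℝ (fun y => fderiv ℝ φ y (Pi.single j 1)) x (Pi.single i 1))
            * fderiv ℝ ψ x (Pi.single j 1) * fderiv ℝ ψ x (Pi.single i 1))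
      + (∑ i : Fin n, ∑ j : Fin n,
          (fderiv ℝ (fun y => fderiv ℝ φ y (Pi.single j 1)) x (Pi.single i 1))
            * fderiv ℝ φ x (Pi.single j 1) * fderiv ℝ φ x (Pi.single i 1)) = 0 := by
  have cφ : ∀ x ∈ Ω, ContDiffAt ℝ 2 φ x := fun x hx => hφ.contDiffAt (hΩ.mem_nhds hx)
  have cψ : ∀ x ∈ Ω, ContDiffAt ℝ 2 ψ x := fun x hx => hψ.contDiffAt (hΩ.mem_nhds hx)
  have hd : ∀ x ∈ Ω, ∀ v, fderiv ℝ (fun y => (φ y : ℂ) + Complex.I * (ψ y : ℂ)) x v =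
      (fderiv ℝ φ x v : ℂ) + Complex.I * (fderiv ℝ ψ x v : ℂ) := by
    intro x hx v
    have h1 : HasFDerivAt (fun y => (φ y : ℂ)) (Complex.ofRealCLM.comp (fderiv ℝ φ x)) x :=
      Complex.ofRealCLM.hasFDerivAt.comp x
        ((cφ x hx).differentiableAt (by norm_num)).hasFDerivAt
    have h2 : HasFDerivAt (fun y => (ψ y : ℂ)) (Complex.ofRealCLM.comp (fderiv ℝ ψ x)) x :=
      Complex.ofRealCLM.hasFDerivAt.comp x
        ((cψ x hx).differentiableAt (by norm_num)).hasFDerivAt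
    rw [(h1.fun_add (h2.const_mul Complex.I)).fderiv]
    simp
  have hre : ∀ x ∈ Ω, ∑ j : Fin n, fderiv ℝ φ x (Pi.single j 1) * fderiv ℝ φ x (Pi.single j 1) =
      ∑ j : Fin n, fderiv ℝ ψ x (Pi.single j 1) * fderiv ℝ ψ x (Pi.single j 1) := by
    intro x hx
    have h := congrArg Complex.re (heik x hx)
    simp only [hd x hx, Complex.re_sum] at h
    simp [pow_two, Finset.sum_sub_distrib] at h
    linarith
  have him : ∀ x ∈ Ω,
      ∑ j : Fin n, fderiv ℝ φ x (Pi.single j 1) * fderiv ℝ ψ x (Pi.single j 1) = 0 := by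
    intro x hx
    have h := congrArg Complex.im (heik x hx)
    simp only [hd x hx, Complex.im_sum] at h
    simp [pow_two, Finset.sum_add_distrib] at h
    simp only [mul_comm (fderiv ℝ ψ x _) (fderiv ℝ φ x _)] at h
    linarith
  intro x hx
  have e1 := fun i : Fin n => congrArg (fun L => L (Pi.single i (1 : ℝ)))
    (Filter.EventuallyEq.fderiv_eq (𝕜 := ℝ) (Filter.eventuallyEq_of_mem (hΩ.mem_nhds hx) hre))
  have e2 := fun i : Fin n => congrArg (fun L => L (Pi.single i (1 : ℝ)))
    (Filter.EventuallyEq.fderiv_eq (𝕜 := ℝ) (f := fun _ => (0 : ℝ))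
      (Filter.eventuallyEq_of_mem (hΩ.mem_nhds hx) him))
  simp only [aux_prod (cφ x hx) (cφ x hx), aux_prod (cψ x hx) (cψ x hx)] at e1
  simp only [aux_prod (cφ x hx) (cψ x hx)] at e2
  have hs : ∀ i j : Fin n, fderiv ℝ (fun y => fderiv ℝ ψ y (Pi.single j 1)) x (Pi.single i 1) =
      fderiv ℝ (fun y => fderiv ℝ ψ y (Pi.single i 1)) x (Pi.single j 1) :=
    fun i j => aux_symm (cψ x hx) _ _
  simp only [fderiv_fun_const, Pi.zero_apply, ContinuousLinearMap.zero_apply] at e2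
  generalize hA : (fun i j : Fin n =>
    fderiv ℝ (fun y => fderiv ℝ φ y (Pi.single j 1)) x (Pi.single i 1)) = A
  generalize hB : (fun i j : Fin n =>
    fderiv ℝ (fun y => fderiv ℝ ψ y (Pi.single j 1)) x (Pi.single i 1)) = B
  generalize ha : (fun j : Fin n => fderiv ℝ φ x (Pi.single j 1)) = a
  generalize hb : (fun j : Fin n => fderiv ℝ ψ x (Pi.single j 1)) = b
  have hA' := fun i j => congrFun (congrFun hA i) j
  have hB' := fun i j => congrFun (congrFun hB i) j
  have ha' := fun j => congrFun ha j
  have hb' := fun j => congrFun hb j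
  simp only [hA', hB', ha', hb'] at e1 e2 hs ⊢
  have f2 : ∑ i, ∑ j, A i j * b j * b i = - ∑ i, ∑ j, B i j * a j * b i := by
    rw [eq_neg_iff_add_eq_zero, ← Finset.sum_add_distrib]
    refine Finset.sum_eq_zero fun i _ => ?_
    have := congrArg (· * b i) (e2 i)
    simp only [Finset.sum_mul, zero_mul] at this
    rw [← Finset.sum_add_distrib, ← this]
    exact Finset.sum_congr rfl fun j _ => by ring
  have f1 : ∑ i, ∑ j, A i j * a j * a i = ∑ i, ∑ j, B i j * b j * a i := by
    refine Finset.sum_congr rfl fun i _ => ?_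
    have := congrArg (· * (a i / 2)) (e1 i)
    simp only [Finset.sum_mul] at this
    convert this using 1 <;> exact Finset.sum_congr rfl fun j _ => by ring
  have f3 : ∑ i, ∑ j, B i j * a j * b i = ∑ i, ∑ j, B i j * b j * a i := by
    rw [Finset.sum_comm]
    refine Finset.sum_congr rfl fun i _ => Finset.sum_congr rfl fun j _ => ?_
    rw [hs j i]; ring
  rw [f1, f2, f3]; ring
end

section
/- Let Ω ⊆ ℝ² ≅ ℂ be an open connected set and let Φ : Ω → ℂ be twice continuously differentiable and solve the Eikonal equation on Ω, i.e. (∂Φ/∂x₁)² + (∂Φ/∂x₂)² = 0 on Ω. Then Φ is either holomorphic on Ω or antiholomorphic on Ω; equivalently, either Φ is complex-differentiable at every point of Ω, or the function z ↦ conj(Φ(z)) is complex-differentiable at every point of Ω. -/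
/-- Let `Ω ⊆ ℝ² ≅ ℂ` be an open connected set and `Φ : Ω → ℂ` be `C²`
and solve the Eikonal equation `(∂Φ/∂x₁)² + (∂Φ/∂x₂)² = 0` on `Ω`. Then `Φ` is either
holomorphic on `Ω` or antiholomorphic on `Ω` (i.e. `z ↦ conj (Φ z)` is holomorphic). -/
theorem stmt_3 (Ω : Set ℂ) (hΩo : IsOpen Ω) (hΩc : IsConnected Ω)
    (Φ : ℂ → ℂ) (hΦ : ContDiffOn ℝ 2 Φ Ω)
    (heik : ∀ z ∈ Ω, (fderiv ℝ Φ z 1) ^ 2 + (fderiv ℝ Φ z Complex.I) ^ 2 = 0) :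
    (∀ z ∈ Ω, DifferentiableAt ℂ Φ z) ∨
    (∀ z ∈ Ω, DifferentiableAt ℂ (fun w => (starRingEnd ℂ) (Φ w)) z) := by
  have hI : Complex.I ^ 2 = -1 := Complex.I_sq
  have hF : ContDiffOn ℝ 1 (fderiv ℝ Φ) Ω :=
    hΦ.fderiv_of_isOpen hΩo (by norm_num)
  have hΦd : ∀ z ∈ Ω, DifferentiableAt ℝ Φ z := fun z hz =>
    (hΦ.differentiableOn (by norm_num)).differentiableAt (hΩo.mem_nhds hz)
  have hFd : ∀ z ∈ Ω, DifferentiableAt ℝ (fderiv ℝ Φ) z := fun z hz =>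
    (hF.differentiableOn (by norm_num)).differentiableAt (hΩo.mem_nhds hz)
  have hF2 : ContinuousOn (fderiv ℝ (fderiv ℝ Φ)) Ω :=
    hF.continuousOn_fderiv_of_isOpen hΩo (by norm_num)
  have hsymm : ∀ z ∈ Ω, fderiv ℝ (fderiv ℝ Φ) z Complex.I 1
      = fderiv ℝ (fderiv ℝ Φ) z 1 Complex.I := fun z hz =>
    (hΦ.contDiffAt (hΩo.mem_nhds hz)).isSymmSndFDerivAt (by simp) _ _
  set g : ℂ → ℂ := fun z => fderiv ℝ Φ z 1 - Complex.I * fderiv ℝ Φ z Complex.I with hg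
  set h : ℂ → ℂ := fun z => fderiv ℝ Φ z 1 + Complex.I * fderiv ℝ Φ z Complex.I with hh
  have hgh : ∀ z ∈ Ω, g z = 0 ∨ h z = 0 := by
    intro z hz
    rw [← mul_eq_zero]
    simp only [hg, hh]
    linear_combination heik z hz - (fderiv ℝ Φ z Complex.I)^2 * hI
  have happ : ∀ z ∈ Ω, ∀ v : ℂ, HasFDerivAt (fun w => fderiv ℝ Φ w v)
      ((fderiv ℝ (fderiv ℝ Φ) z).flip v) z := by
    intro z hz v
    have := (hFd z hz).hasFDerivAt.clm_apply (hasFDerivAt_const v z)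
    simpa using this
  have hgd : ∀ z ∈ Ω, HasFDerivAt g ((fderiv ℝ (fderiv ℝ Φ) z).flip 1 -
      Complex.I • (fderiv ℝ (fderiv ℝ Φ) z).flip Complex.I) z := fun z hz =>
    (happ z hz 1).sub ((happ z hz Complex.I).const_mul Complex.I)
  have hhd : ∀ z ∈ Ω, HasFDerivAt h ((fderiv ℝ (fderiv ℝ Φ) z).flip 1 +
      Complex.I • (fderiv ℝ (fderiv ℝ Φ) z).flip Complex.I) z := fun z hz =>
    (happ z hz 1).add ((happ z hz Complex.I).const_mul Complex.I)
  set D : ℂ → ℂ := fun z => fderiv ℝ (fderiv ℝ Φ) z 1 1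
    + fderiv ℝ (fderiv ℝ Φ) z Complex.I Complex.I with hD
  have hDc : ContinuousOn D Ω := by
    rw [hD]
    fun_prop
  have hDg : ∀ z ∈ Ω, D z = fderiv ℝ g z 1 + Complex.I * fderiv ℝ g z Complex.I := by
    intro z hz
    rw [(hgd z hz).fderiv]
    simp [hD, hsymm z hz]
    linear_combination (fderiv ℝ (fderiv ℝ Φ) z Complex.I Complex.I) * hI
  have hDh : ∀ z ∈ Ω, D z = fderiv ℝ h z 1 - Complex.I * fderiv ℝ h z Complex.I := by
    intro z hz
    rw [(hhd z hz).fderiv]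
    simp [hD, hsymm z hz]
    linear_combination (fderiv ℝ (fderiv ℝ Φ) z Complex.I Complex.I) * hI
  have hDg0 : ∀ z ∈ Ω, g z ≠ 0 → D z = 0 := by
    intro z hz hgz
    have : h =ᶠ[nhds z] fun _ => 0 := by
      filter_upwards [(hgd z hz).continuousAt.eventually_ne hgz, hΩo.mem_nhds hz] with w hw hwΩ
      exact (hgh w hwΩ).resolve_left hw
    rw [hDh z hz, this.fderiv_eq]
    simp
  have hD0 : ∀ z ∈ Ω, D z = 0 := by
    intro z hz
    by_contra hne
    have : g =ᶠ[nhds z] fun _ => 0 := by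
      filter_upwards [(hDc.continuousAt (hΩo.mem_nhds hz)).eventually_ne hne,
        hΩo.mem_nhds hz] with w hw hwΩ
      by_contra hgw
      exact hw (hDg0 w hwΩ hgw)
    apply hne
    rw [hDg z hz, this.fderiv_eq]
    simp
  have hga : AnalyticOnNhd ℂ g Ω := by
    refine DifferentiableOn.analyticOnNhd (fun z hz => ?_) hΩo
    refine (differentiableAt_complex_iff_differentiableAt_real.2
      ⟨(hgd z hz).differentiableAt, ?_⟩).differentiableWithinAt
    have h1 := hDg z hz
    rw [hD0 z hz] at h1
    rw [smul_eq_mul]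
    linear_combination Complex.I * h1 + fderiv ℝ g z Complex.I * hI
  by_cases hall : ∀ z ∈ Ω, h z = 0
  · left
    intro z hz
    refine differentiableAt_complex_iff_differentiableAt_real.2 ⟨hΦd z hz, ?_⟩
    have h1 := hall z hz
    simp only [hh] at h1
    rw [smul_eq_mul]
    linear_combination (-Complex.I) * h1 + fderiv ℝ Φ z Complex.I * hI
  · right
    push Not at hall
    obtain ⟨z₀, hz₀, hne⟩ := hall
    have hev : g =ᶠ[nhds z₀] 0 := by
      filter_upwards [(hhd z₀ hz₀).continuousAt.eventually_ne hne, hΩo.mem_nhds hz₀] with w hw hwΩ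
      exact (hgh w hwΩ).resolve_right hw
    have hg0 := hga.eqOn_zero_of_preconnected_of_eventuallyEq_zero hΩc.isPreconnected hz₀ hev
    intro z hz
    have hc : HasFDerivAt (fun w => (starRingEnd ℂ) (Φ w))
        ((Complex.conjCLE : ℂ →L[ℝ] ℂ).comp (fderiv ℝ Φ z)) z :=
      (Complex.conjCLE : ℂ →L[ℝ] ℂ).hasFDerivAt.comp z (hΦd z hz).hasFDerivAt
    refine differentiableAt_complex_iff_differentiableAt_real.2 ⟨hc.differentiableAt, ?_⟩
    rw [hc.fderiv]
    have h1 : g z = 0 := hg0 hz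
    simp only [hg] at h1
    have h2 : fderiv ℝ Φ z Complex.I = -Complex.I * fderiv ℝ Φ z 1 := by
      linear_combination Complex.I * h1 + fderiv ℝ Φ z Complex.I * hI
    simp [h2]
end

section
/- Let Ω ⊆ ℝⁿ \ {0} be an open set and let Φ : Ω → ℂ be continuously differentiable and solve the Eikonal equation on Ω (i.e. ∑_{j=1}^n (∂Φ/∂x_j)² = 0 on Ω). Let ι(x) = x/|x|² denote inversion with respect to the unit sphere, and set Ω* = {x ∈ ℝⁿ \ {0} : ι(x) ∈ Ω}. Then the composition Ψ = Φ ∘ ι also solves the Eikonal equation on Ω*: ∑_{j=1}^n (∂Ψ/∂x_j)² = 0 on Ω*. -/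
/-- Let `Ω ⊆ ℝⁿ \ {0}` be open and `Φ : Ω → ℂ` be `C¹` and solve the
Eikonal equation `∑_j (∂Φ/∂x_j)² = 0` on `Ω`. Let `ι(x) = x/|x|²` be the inversion with
respect to the unit sphere and `Ω* = {x ≠ 0 : ι(x) ∈ Ω}`. Then `Ψ = Φ ∘ ι` also solves
the Eikonal equation on `Ω*`. -/
theorem stmt_4 {n : ℕ} (Ω : Set (EuclideanSpace ℝ (Fin n))) (hΩ : IsOpen Ω)
    (hΩ0 : ∀ x ∈ Ω, x ≠ 0)
    (Φ : EuclideanSpace ℝ (Fin n) → ℂ) (hΦ : ContDiffOn ℝ 1 Φ Ω)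
    (heik : ∀ x ∈ Ω, ∑ j : Fin n,
        (fderiv ℝ Φ x (EuclideanSpace.single j 1)) ^ 2 = 0) :
    ∀ x : EuclideanSpace ℝ (Fin n), x ≠ 0 → (‖x‖ ^ 2)⁻¹ • x ∈ Ω →
      ∑ j : Fin n,
        (fderiv ℝ (fun y => Φ ((‖y‖ ^ 2)⁻¹ • y)) x (EuclideanSpace.single j 1)) ^ 2 = 0 := by
  intro x hx hxΩ
  have hr : ‖x‖ ^ 2 ≠ 0 := pow_ne_zero 2 (norm_ne_zero_iff.mpr hx)
  have hD : DifferentiableAt ℝ Φ ((‖x‖ ^ 2)⁻¹ • x) :=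
    (hΦ.differentiableOn (by norm_num)).differentiableAt (hΩ.mem_nhds hxΩ)
  have h1 : HasFDerivAt (fun y : EuclideanSpace ℝ (Fin n) => ‖y‖ ^ 2)
      (2 • innerSL ℝ x) x := (hasStrictFDerivAt_norm_sq x).hasFDerivAt
  have h2 := (hasDerivAt_inv hr).comp_hasFDerivAt x h1
  have h3 : HasFDerivAt (fun y : EuclideanSpace ℝ (Fin n) => (‖y‖ ^ 2)⁻¹ • y)
      ((‖x‖ ^ 2)⁻¹ • ContinuousLinearMap.id ℝ (EuclideanSpace ℝ (Fin n)) +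
        (-((‖x‖ ^ 2) ^ 2)⁻¹ • 2 • (innerSL ℝ) x).smulRight x) x :=
    h2.smul (hasFDerivAt_id x)
  have h4 := (HasFDerivAt.comp (f := fun y : EuclideanSpace ℝ (Fin n) => (‖y‖ ^ 2)⁻¹ • y)
    x hD.hasFDerivAt h3).fderiv
  have he := heik _ hxΩ
  set L := fderiv ℝ Φ ((‖x‖ ^ 2)⁻¹ • x) with hL
  have hLx : L x = ∑ j, (x j : ℂ) * L (EuclideanSpace.single j 1) := by
    have hxs : x = ∑ j, x j • EuclideanSpace.single j (1 : ℝ) := by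
      ext i
      simp [Finset.sum_apply, Pi.single_apply]
    conv_lhs => rw [hxs]
    simp [map_sum]
  have hn : ((‖x‖ ^ 2 : ℝ) : ℂ) = ∑ j, (x j : ℂ) ^ 2 := by
    rw [EuclideanSpace.real_norm_sq_eq]
    push_cast
    rfl
  have key : ∀ j, fderiv ℝ (fun y => Φ ((‖y‖ ^ 2)⁻¹ • y)) x (EuclideanSpace.single j 1)
      = ((‖x‖ ^ 2 : ℝ) : ℂ)⁻¹ * L (EuclideanSpace.single j 1)
        - 2 * (((‖x‖ ^ 2 : ℝ) : ℂ)⁻¹) ^ 2 * (x j : ℂ) * L x := by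
    intro j
    refine (congrArg (fun T => T (EuclideanSpace.single j 1)) h4).trans ?_
    simp [EuclideanSpace.inner_single_right]
    ring
  have hrc : ((‖x‖ ^ 2 : ℝ) : ℂ) ≠ 0 := by exact_mod_cast hr
  simp only [key]
  generalize ((‖x‖ ^ 2 : ℝ) : ℂ) = r at *
  have expand : ∀ j, (r⁻¹ * L (EuclideanSpace.single j 1)
        - 2 * (r⁻¹) ^ 2 * (x j : ℂ) * L x) ^ 2
      = r⁻¹ ^ 2 * (L (EuclideanSpace.single j 1)) ^ 2
        - 4 * r⁻¹ ^ 3 * L x * ((x j : ℂ) * L (EuclideanSpace.single j 1))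
        + 4 * r⁻¹ ^ 4 * L x ^ 2 * (x j : ℂ) ^ 2 := fun j => by ring
  simp only [expand]
  rw [Finset.sum_add_distrib, Finset.sum_sub_distrib, ← Finset.mul_sum, ← Finset.mul_sum,
    ← Finset.mul_sum, he, ← hLx, ← hn]
  field_simp
  ring
end

section
/- Let Ω = {x ∈ ℝ³ : x₁² + x₂² > 0} (the complement of the x₃-axis), and define Φ : Ω → ℂ by Φ(x) = ln|x| + i·arccos(x₃/|x|), where |x| is the Euclidean norm (so Re Φ = ln r and Im Φ = θ is the polar angle in spherical coordinates). Then Φ solves the Eikonal equation on Ω: ∑_{j=1}^3 (∂Φ/∂x_j)² = 0 at every point of Ω. -/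
/-- Let `Ω = {x ∈ ℝ³ : x₁² + x₂² > 0}` and define
`Φ(x) = ln|x| + i·arccos(x₃/|x|)` (so `Re Φ = ln r`, `Im Φ = θ` in spherical coordinates).
Then `Φ` solves the Eikonal equation `∑_{j=1}^3 (∂Φ/∂x_j)² = 0` on `Ω`. -/
theorem stmt_5 :
    ∀ x : EuclideanSpace ℝ (Fin 3), (x 0) ^ 2 + (x 1) ^ 2 > 0 →
      ∑ j : Fin 3,
        (fderiv ℝ (fun y : EuclideanSpace ℝ (Fin 3) =>
            ((Real.log ‖y‖ : ℝ) : ℂ) + Complex.I * ((Real.arccos (y 2 / ‖y‖) : ℝ) : ℂ))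
          x (EuclideanSpace.single j 1)) ^ 2 = 0 := by
  intro x hx
  have hr2 : ‖x‖ ^ 2 = x 0 ^ 2 + x 1 ^ 2 + x 2 ^ 2 := by
    rw [EuclideanSpace.norm_sq_eq]
    simp [Fin.sum_univ_three]
  have hx0 : x ≠ 0 := by
    rintro rfl
    simp at hx
  have hr : 0 < ‖x‖ := norm_pos_iff.mpr hx0
  have hN : HasFDerivAt (fun y : EuclideanSpace ℝ (Fin 3) => ‖y‖) (‖x‖⁻¹ • innerSL ℝ x) x := by
    have h1 := ((hasStrictFDerivAt_norm_sq x).hasFDerivAt).sqrt (by positivity)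
    simp only [Real.sqrt_sq (norm_nonneg _)] at h1
    have e : (1 / (2 * ‖x‖)) • 2 • innerSL ℝ x = ‖x‖⁻¹ • innerSL ℝ x := by
      rw [← Nat.cast_smul_eq_nsmul ℝ, smul_smul]
      congr 1
      push_cast
      field_simp
    rw [← e]
    exact h1
  have hlog := hN.log hr.ne'
  have hc : HasFDerivAt (fun y : EuclideanSpace ℝ (Fin 3) => y 2)
      (EuclideanSpace.proj (2 : Fin 3) : EuclideanSpace ℝ (Fin 3) →L[ℝ] ℝ) x :=
    (EuclideanSpace.proj (2 : Fin 3) : EuclideanSpace ℝ (Fin 3) →L[ℝ] ℝ).hasFDerivAt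
  have hu : (x 2 / ‖x‖) ^ 2 < 1 := by
    rw [div_pow, div_lt_one (by positivity)]
    linarith
  have hne := abs_lt.mp ((sq_lt_one_iff_abs_lt_one _).mp hu)
  have hinv : HasFDerivAt (fun y : EuclideanSpace ℝ (Fin 3) => ‖y‖⁻¹)
      (-(‖x‖ ^ 2)⁻¹ • (‖x‖⁻¹ • innerSL ℝ x)) x :=
    (hasDerivAt_inv hr.ne').comp_hasFDerivAt x hN
  have hq := hc.mul hinv
  have hacos := (Real.hasDerivAt_arccos (x := x 2 * ‖x‖⁻¹)
    (by rw [← div_eq_mul_inv]; exact hne.1.ne') (by rw [← div_eq_mul_inv]; exact hne.2.ne)).comp_hasFDerivAt x hq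
  have hL := (Complex.ofRealCLM.hasFDerivAt).comp x hlog
  have hA := ((Complex.ofRealCLM.hasFDerivAt).comp x hacos).const_mul Complex.I
  have hT := hL.add hA
  have hs : (1 / √(1 - (x 2 * ‖x‖⁻¹) ^ 2)) ^ 2 * (x 0 ^ 2 + x 1 ^ 2) = ‖x‖ ^ 2 := by
    rw [div_pow, Real.sq_sqrt (by rw [← div_eq_mul_inv]; linarith)]
    have : 1 - (x 2 * ‖x‖⁻¹) ^ 2 = (x 0 ^ 2 + x 1 ^ 2) / ‖x‖ ^ 2 := by
      field_simp
      linarith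
    rw [this]
    field_simp
  have hf : (fun y : EuclideanSpace ℝ (Fin 3) =>
            ((Real.log ‖y‖ : ℝ) : ℂ) + Complex.I * ((Real.arccos (y 2 / ‖y‖) : ℝ) : ℂ)) = _ :=
    funext fun y => by rw [div_eq_mul_inv]
  rw [hf]
  erw [hT.fderiv]
  generalize 1 / √(1 - (x 2 * ‖x‖⁻¹) ^ 2) = s at *
  clear hT hL hA hacos hq hinv hf hlog hN hc hne hu
  rw [Fin.sum_univ_three]
  simp [EuclideanSpace.inner_single_right]
  generalize ‖x‖ = r at *
  generalize x 0 = a at *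
  generalize x 1 = b at *
  generalize x 2 = c at *
  have h1 : (r : ℂ) ≠ 0 := by exact_mod_cast hr.ne'
  have h2 : (r : ℂ) ^ 2 = a ^ 2 + b ^ 2 + c ^ 2 := by exact_mod_cast hr2
  have h3 : (s : ℂ) ^ 2 * (a ^ 2 + b ^ 2) = r ^ 2 := by exact_mod_cast hs
  have hI := Complex.I_sq
  field_simp
  have h4 : (c : ℂ) ^ 2 + -(r : ℂ) ^ 2 = -((a : ℂ) ^ 2 + b ^ 2) := by rw [h2]; ring
  rw [h4]
  linear_combination ((a : ℂ) ^ 2 + b ^ 2 + c ^ 2) * s ^ 2 * (a ^ 2 + b ^ 2) * hI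
    - ((a : ℂ) ^ 2 + b ^ 2 + c ^ 2) * h3
end

section
/- Let n ≥ 2, let v ∈ ℝⁿ with v ≠ 0, let Q : ℝⁿ → ℝ be a quadratic form and c ∈ ℝ. Suppose that Q(ξ) + cτ² = 0 for every ξ ∈ ℝⁿ and τ ∈ ℝ satisfying ⟨ξ, v⟩ = 0 and |ξ|² = τ²|v|². Then there exist m ∈ ℝ and a linear form ℓ : ℝⁿ → ℝ such that Q(ξ) + cτ² = m(|ξ|² − τ²|v|²) + ℓ(ξ)·⟨ξ, v⟩ for all ξ ∈ ℝⁿ and all τ ∈ ℝ. -/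
open Matrix

/-- Let `n ≥ 2`, `v ∈ ℝⁿ` nonzero, `Q(ξ) = ⟨Aξ, ξ⟩` a quadratic form
(`A` symmetric) and `c ∈ ℝ`. If `Q(ξ) + cτ² = 0` whenever `⟨ξ, v⟩ = 0` and
`|ξ|² = τ²|v|²`, then there exist `m ∈ ℝ` and a linear form `ℓ` such that
`Q(ξ) + cτ² = m(|ξ|² − τ²|v|²) + ℓ(ξ)·⟨ξ, v⟩` for all `ξ, τ`. -/
theorem stmt_6 {n : ℕ} (hn : 2 ≤ n) (v : Fin n → ℝ) (hv : v ≠ 0)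
    (A : Matrix (Fin n) (Fin n) ℝ) (hA : A.IsSymm) (c : ℝ)
    (h : ∀ (ξ : Fin n → ℝ) (τ : ℝ), ξ ⬝ᵥ v = 0 → ξ ⬝ᵥ ξ = τ ^ 2 * (v ⬝ᵥ v) →
      (A.mulVec ξ) ⬝ᵥ ξ + c * τ ^ 2 = 0) :
    ∃ (m : ℝ) (ℓ : (Fin n → ℝ) →ₗ[ℝ] ℝ), ∀ (ξ : Fin n → ℝ) (τ : ℝ),
      (A.mulVec ξ) ⬝ᵥ ξ + c * τ ^ 2
        = m * (ξ ⬝ᵥ ξ - τ ^ 2 * (v ⬝ᵥ v)) + ℓ ξ * (ξ ⬝ᵥ v) := by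
  have hN : v ⬝ᵥ v ≠ 0 := fun h0 => hv (dotProduct_self_eq_zero.1 h0)
  have hNpos : 0 < v ⬝ᵥ v :=
    lt_of_le_of_ne (Finset.sum_nonneg fun i _ => mul_self_nonneg (v i)) (Ne.symm hN)
  have hsym : ∀ x y : Fin n → ℝ, (A.mulVec x) ⬝ᵥ y = x ⬝ᵥ (A.mulVec y) := by
    intro x y
    rw [dotProduct_mulVec, ← mulVec_transpose, hA.eq]
  have key : ∀ η : Fin n → ℝ, η ⬝ᵥ v = 0 →
      (A.mulVec η) ⬝ᵥ η = -c / (v ⬝ᵥ v) * (η ⬝ᵥ η) := by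
    intro η hη
    have h0 : 0 ≤ (η ⬝ᵥ η) / (v ⬝ᵥ v) :=
      div_nonneg (Finset.sum_nonneg fun i _ => mul_self_nonneg (η i)) hNpos.le
    have h1 := h η (Real.sqrt ((η ⬝ᵥ η) / (v ⬝ᵥ v))) hη
      (by rw [Real.sq_sqrt h0]; field_simp)
    rw [Real.sq_sqrt h0] at h1
    rw [eq_neg_of_add_eq_zero_left h1]
    ring
  let ℓ : (Fin n → ℝ) →ₗ[ℝ] ℝ :=
    { toFun := fun ξ => (2 * (ξ ⬝ᵥ (A.mulVec v)) + 2 * (c / (v ⬝ᵥ v)) * (ξ ⬝ᵥ v)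
        - (ξ ⬝ᵥ v) / (v ⬝ᵥ v) * ((v ⬝ᵥ (A.mulVec v)) + c)) / (v ⬝ᵥ v)
      map_add' := by
        intro x y
        simp only [add_dotProduct]
        ring
      map_smul' := by
        intro r x
        simp only [smul_dotProduct, smul_eq_mul, RingHom.id_apply]
        ring }
  refine ⟨-c / (v ⬝ᵥ v), ℓ, fun ξ τ => ?_⟩
  have hk := key (ξ - ((ξ ⬝ᵥ v) / (v ⬝ᵥ v)) • v) (by
    simp only [sub_dotProduct, smul_dotProduct, smul_eq_mul]
    field_simp
    ring)
  have hc : v ⬝ᵥ (A.mulVec ξ) = ξ ⬝ᵥ (A.mulVec v) := by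
    rw [← hsym, dotProduct_comm]
  rw [hsym] at hk ⊢
  simp only [mulVec_sub, mulVec_smul, sub_dotProduct, dotProduct_sub, smul_dotProduct,
    dotProduct_smul, smul_eq_mul, hc, dotProduct_comm v ξ] at hk
  change _ = _ + (2 * (ξ ⬝ᵥ (A.mulVec v)) + 2 * (c / (v ⬝ᵥ v)) * (ξ ⬝ᵥ v)
        - (ξ ⬝ᵥ v) / (v ⬝ᵥ v) * ((v ⬝ᵥ (A.mulVec v)) + c)) / (v ⬝ᵥ v) * (ξ ⬝ᵥ v)
  generalize ξ ⬝ᵥ (A.mulVec ξ) = a at *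
  generalize ξ ⬝ᵥ (A.mulVec v) = b at *
  generalize v ⬝ᵥ (A.mulVec v) = d at *
  generalize ξ ⬝ᵥ ξ = e at *
  generalize ξ ⬝ᵥ v = f at *
  generalize v ⬝ᵥ v = N at *
  have ha : a = f / N * b + f / N * (b - f / N * d)
      + -c / N * (e - f / N * f - f / N * (f - f / N * N)) := by
    linarith
  rw [ha]
  field_simp
  ring
end

section
/- Let Ω ⊂ ℝ² ≅ ℂ be a bounded open set, let U be an open set containing the closure of Ω, and let Φ : U → ℂ be holomorphic. Assume the set of critical points of Φ in the closure of Ω (zeros of Φ′) is finite and each such critical point z̃ is nondegenerate: Φ″(z̃) ≠ 0. Then for every Lebesgue-integrable function g ∈ L¹(Ω), ∫_Ω g(x) e^{τ(Φ(x) − conj(Φ(x)))} dx → 0 as τ → +∞. -/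
open MeasureTheory Filter Topology in
lemma aux_pos {α : Type*} [MeasurableSpace α] (μ : Measure α) (ψ : α → ℝ)
    (hψ : AEMeasurable ψ μ)
    (hac : ∀ N : Set ℝ, MeasurableSet N → volume N = 0 → μ (ψ ⁻¹' N) = 0)
    (h : α → ℝ) (hh : Integrable h μ) :
    Tendsto (fun τ : ℝ => ∫ x, ((max (h x) 0 : ℝ) : ℂ) *
      Complex.exp (τ * (2 * Complex.I * (ψ x : ℂ))) ∂μ) atTop (𝓝 0) := by
  set d : α → ENNReal := fun x => ENNReal.ofReal (h x) with hd
  have hdm : AEMeasurable d μ := hh.aemeasurable.ennreal_ofReal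
  set κ := μ.withDensity d with hκ
  have hκμ : κ ≪ μ := withDensity_absolutelyContinuous _ _
  have : IsFiniteMeasure κ := isFiniteMeasure_withDensity_ofReal hh.2
  have hψκ : AEMeasurable ψ κ := hψ.mono_ac hκμ
  have hν : κ.map ψ ≪ volume := by
    refine Measure.AbsolutelyContinuous.mk fun N hN h0 => ?_
    rw [Measure.map_apply_of_aemeasurable hψκ hN]
    exact hκμ (hac N hN h0)
  have key : ∀ τ : ℝ, ∫ x, ((max (h x) 0 : ℝ) : ℂ) *
      Complex.exp (τ * (2 * Complex.I * (ψ x : ℂ))) ∂μ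
      = ∫ v : ℝ, Real.fourierChar (-(v * (-(τ / Real.pi)))) •
          ((((κ.map ψ).rnDeriv volume v).toReal : ℝ) : ℂ) := by
    intro τ
    have h1 : ∫ x, ((max (h x) 0 : ℝ) : ℂ) *
      Complex.exp (τ * (2 * Complex.I * (ψ x : ℂ))) ∂μ
       = ∫ x, Complex.exp (τ * (2 * Complex.I * (ψ x : ℂ))) ∂κ := by
      rw [hκ, integral_withDensity_eq_integral_toReal_smul₀ hdm (by simp [hd])]
      refine integral_congr_ae (Eventually.of_forall fun x => ?_)
      simp only [hd, ENNReal.toReal_ofReal', Complex.real_smul]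
    rw [h1, ← integral_map (f := fun s : ℝ => Complex.exp (τ * (2 * Complex.I * (s : ℂ)))) hψκ
      (by fun_prop), ← integral_rnDeriv_smul hν]
    refine integral_congr_ae (Eventually.of_forall fun v => ?_)
    simp only [Circle.smul_def, Real.fourierChar_apply, Complex.real_smul, smul_eq_mul]
    rw [mul_comm]
    congr 2
    have : (Real.pi : ℂ) ≠ 0 := by exact_mod_cast Real.pi_ne_zero
    push_cast
    field_simp
  simp_rw [key]
  refine (Real.tendsto_integral_exp_smul_cocompact (fun v : ℝ =>
    ((((κ.map ψ).rnDeriv volume v).toReal : ℝ) : ℂ))).comp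
      (Tendsto.mono_right ?_ atBot_le_cocompact)
  exact tendsto_neg_atTop_atBot.comp (tendsto_id.atTop_div_const Real.pi_pos)

open MeasureTheory Filter Topology in
lemma aux_complex {α : Type*} [MeasurableSpace α] (μ : Measure α) (ψ : α → ℝ)
    (hψ : AEMeasurable ψ μ)
    (hac : ∀ N : Set ℝ, MeasurableSet N → volume N = 0 → μ (ψ ⁻¹' N) = 0)
    (g : α → ℂ) (hg : Integrable g μ) :
    Tendsto (fun τ : ℝ => ∫ x, g x *
      Complex.exp (τ * (2 * Complex.I * (ψ x : ℂ))) ∂μ) atTop (𝓝 0) := by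
  have hre : Integrable (fun x => (g x).re) μ := hg.re
  have him : Integrable (fun x => (g x).im) μ := hg.im
  have hI : ∀ (h : α → ℝ), Integrable h μ → ∀ τ : ℝ,
      Integrable (fun x => ((max (h x) 0 : ℝ) : ℂ) *
        Complex.exp (τ * (2 * Complex.I * (ψ x : ℂ)))) μ := by
    intro h hh τ
    have h1 : Integrable (fun x => ((max (h x) 0 : ℝ) : ℂ)) μ := hh.pos_part.ofReal
    refine h1.mul_bdd (c := 1) ?_ (Eventually.of_forall fun x => ?_)
    · have : AEMeasurable (fun x => Complex.exp (τ * (2 * Complex.I * (ψ x : ℂ)))) μ := by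
        fun_prop
      exact this.aestronglyMeasurable
    · rw [Complex.norm_exp]
      simp
  have h1 := aux_pos μ ψ hψ hac _ hre
  have h2 := aux_pos μ ψ hψ hac _ hre.neg
  have h3 := aux_pos μ ψ hψ hac _ him
  have h4 := aux_pos μ ψ hψ hac _ him.neg
  have H := (h1.sub h2).add ((h3.sub h4).const_mul Complex.I)
  simp only [sub_zero, mul_zero, add_zero] at H
  refine H.congr fun τ => ?_
  have i1 := hI _ hre τ
  have i2 := hI _ hre.neg τ
  have i3 := hI _ him τ
  have i4 := hI _ him.neg τ
  rw [← integral_sub i1 i2, ← integral_sub i3 i4, ← integral_const_mul]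
  refine (integral_add (i1.sub i2) ((i3.sub i4).const_mul Complex.I)).symm.trans ?_
  refine integral_congr_ae (Eventually.of_forall fun x => ?_)
  have e : ∀ a : ℝ, max a 0 - max (-a) 0 = a := fun a => max_zero_sub_max_neg_zero_eq_self a
  have e' : ∀ a : ℝ, ((max a 0 : ℝ) : ℂ) - ((max (-a) 0 : ℝ) : ℂ) = a := fun a => by
    rw [← Complex.ofReal_sub, e]
  simp only [Pi.neg_apply, Pi.sub_apply]
  rw [← sub_mul, ← sub_mul, e', e', ← mul_assoc Complex.I, ← add_mul, mul_comm Complex.I (((g x).im : ℝ) : ℂ),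
    Complex.re_add_im]

open MeasureTheory Filter Topology in
lemma aux_im (N : Set ℝ) (h0 : volume N = 0) :
    volume {w : ℂ | w.im ∈ N} = 0 := by
  have h1 : Measure.QuasiMeasurePreserving (fun w : ℂ => w.im) volume volume :=
    (Measure.quasiMeasurePreserving_snd (μ := (volume : Measure ℝ))
      (ν := (volume : Measure ℝ))).comp
      Complex.volume_preserving_equiv_real_prod.quasiMeasurePreserving
  exact h1.preimage_null h0

open MeasureTheory Filter Topology in
lemma aux_null (U : Set ℂ) (hU : IsOpen U) (Φ : ℂ → ℂ) (hΦ : DifferentiableOn ℂ Φ U)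
    (N : Set ℝ) (h0 : volume N = 0) :
    volume {z | z ∈ U ∧ deriv Φ z ≠ 0 ∧ (Φ z).im ∈ N} = 0 := by
  refine measure_null_of_locally_null _ fun x hx => ?_
  obtain ⟨hxU, hx', -⟩ := hx
  have han : AnalyticAt ℂ Φ x := hΦ.analyticAt (hU.mem_nhds hxU)
  have hs : HasStrictDerivAt Φ (deriv Φ x) x := han.hasStrictDerivAt
  have hs' := hs.hasStrictFDerivAt_equiv hx'
  set e := hs'.toOpenPartialHomeomorph Φ with he
  have hec : (e : ℂ → ℂ) = Φ := hs'.toOpenPartialHomeomorph_coe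
  have hxe : x ∈ e.source := hs'.mem_toOpenPartialHomeomorph_source
  refine ⟨{z | z ∈ U ∧ deriv Φ z ≠ 0 ∧ (Φ z).im ∈ N} ∩ e.source,
    inter_mem_nhdsWithin _ (e.open_source.mem_nhds hxe), ?_⟩
  set T : Set ℂ := {w | w ∈ e.target ∧ e.symm w ∈ U ∧ deriv Φ (e.symm w) ≠ 0 ∧ w.im ∈ N} with hT
  have hT0 : volume T = 0 := measure_mono_null (fun w hw => hw.2.2.2) (aux_im N h0)
  have hd : DifferentiableOn ℝ e.symm T := by
    rintro w ⟨hw, hwU, hw', -⟩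
    have hD : HasDerivAt e (deriv Φ (e.symm w)) (e.symm w) := by
      rw [hec]
      exact (hΦ.differentiableAt (hU.mem_nhds hwU)).hasDerivAt
    exact ((e.hasDerivAt_symm hw hw' hD).differentiableAt.restrictScalars
      ℝ).differentiableWithinAt
  refine measure_mono_null ?_
    (addHaar_image_eq_zero_of_differentiableOn_of_addHaar_eq_zero volume hd hT0)
  rintro z ⟨⟨hzU, hz', hzN⟩, hze⟩
  refine ⟨e z, ⟨e.map_source hze, ?_, ?_, ?_⟩, e.left_inv hze⟩
  · rwa [e.left_inv hze]
  · rwa [e.left_inv hze]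
  · rwa [hec]

/-- (Proposition 7.3.) Let `Ω ⊂ ℂ` be a bounded open set,
`U ⊇ closure Ω` open, `Φ : U → ℂ` holomorphic. Assume the set of critical points of `Φ`
in `closure Ω` is finite and each is nondegenerate (`Φ″ ≠ 0`). Then for every
`g ∈ L¹(Ω)`, `∫_Ω g e^{τ(Φ − conj Φ)} dx → 0` as `τ → +∞`. -/
theorem stmt_9 (Ω : Set ℂ) (hΩo : IsOpen Ω) (hΩb : Bornology.IsBounded Ω)
    (U : Set ℂ) (hU : IsOpen U) (hclU : closure Ω ⊆ U)
    (Φ : ℂ → ℂ) (hΦ : DifferentiableOn ℂ Φ U)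
    (hfin : {z ∈ closure Ω | deriv Φ z = 0}.Finite)
    (hnd : ∀ z ∈ closure Ω, deriv Φ z = 0 → deriv (deriv Φ) z ≠ 0)
    (g : ℂ → ℂ) (hg : MeasureTheory.IntegrableOn g Ω) :
    Filter.Tendsto (fun τ : ℝ =>
        ∫ x in Ω, g x * Complex.exp (τ * (Φ x - (starRingEnd ℂ) (Φ x))))
      Filter.atTop (nhds 0) := by
  have hψ : AEMeasurable (fun x => (Φ x).im) (MeasureTheory.volume.restrict Ω) := by
    have : ContinuousOn (fun x => (Φ x).im) Ω :=
      Complex.continuous_im.comp_continuousOn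
        (hΦ.continuousOn.mono (subset_closure.trans hclU))
    exact this.aemeasurable hΩo.measurableSet
  have H := aux_complex (MeasureTheory.volume.restrict Ω) (fun x => (Φ x).im) hψ ?_ g hg
  · refine H.congr fun τ => ?_
    refine MeasureTheory.integral_congr_ae (Filter.Eventually.of_forall fun x => ?_)
    simp only [Complex.sub_conj]
    congr 3
    push_cast
    ring
  · intro N hN h0
    rw [MeasureTheory.Measure.restrict_apply' hΩo.measurableSet]
    refine MeasureTheory.measure_mono_null ?_
      (MeasureTheory.measure_union_null (aux_null U hU Φ hΦ N h0)
        (hfin.measure_zero MeasureTheory.volume))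
    rintro z ⟨hzN, hzΩ⟩
    have hc := subset_closure hzΩ
    by_cases hz : deriv Φ z = 0
    · exact Or.inr ⟨hc, hz⟩
    · exact Or.inl ⟨hclU hc, hz, hzN⟩
end

section
/- Let c < d be real numbers, let ψ : [c,d] → ℝ be twice continuously differentiable, and assume that the set {x ∈ [c,d] : ψ′(x) = 0} has Lebesgue measure zero. Then for every Lebesgue-integrable function g ∈ L¹(c,d), ∫_c^d g(x) e^{2iτψ(x)} dx → 0 as τ → +∞. -/
open Set Filter Topology MeasureTheory in
theorem aux_piece (S : Set ℝ) (hS : MeasurableSet S) (ψ ψ' : ℝ → ℝ)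
    (hd : ∀ x ∈ S, HasDerivAt ψ (ψ' x) x) (hne : ∀ x ∈ S, ψ' x ≠ 0) (hinj : InjOn ψ S)
    (g : ℝ → ℂ) :
    Tendsto (fun τ : ℝ => ∫ x in S, g x * Complex.exp (2 * Complex.I * τ * ψ x)) atTop (𝓝 0) := by
  classical
  set F : ℝ → ℂ := fun y => (|ψ' (Function.invFunOn ψ S y)|⁻¹ : ℝ) • g (Function.invFunOn ψ S y) with hF
  have hm : MeasurableSet (ψ '' S) :=
    measurable_image_of_fderivWithin hS
      (fun x hx => (hd x hx).hasDerivWithinAt.hasFDerivWithinAt) hinj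
  have h1 := Real.tendsto_integral_exp_smul_cocompact ((ψ '' S).indicator F)
  have h2 : Tendsto (fun τ : ℝ => τ * (-(1 / Real.pi))) atTop (cocompact ℝ) := by
    refine Tendsto.mono_right ?_ atBot_le_cocompact
    exact tendsto_id.atTop_mul_const_of_neg (by simp [Real.pi_pos])
  have h3 := h1.comp h2
  refine h3.congr fun τ => ?_
  simp only [Function.comp]
  have e1 : ∀ v : ℝ, (Real.fourierChar (-(v * (τ * (-(1 / Real.pi)))))) • (ψ '' S).indicator F v
      = (ψ '' S).indicator (fun v => Complex.exp (2 * Complex.I * τ * v) * F v) v := by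
    intro v
    by_cases hv : v ∈ ψ '' S
    · simp only [indicator_of_mem hv, Circle.smul_def, Real.fourierChar_apply, smul_eq_mul]
      congr 2
      have := Real.pi_ne_zero
      have : (Real.pi : ℂ) ≠ 0 := by exact_mod_cast this
      push_cast
      field_simp
    · simp [indicator_of_notMem hv]
  simp_rw [e1]
  rw [integral_indicator hm, integral_image_eq_integral_abs_deriv_smul hS
    (fun x hx => (hd x hx).hasDerivWithinAt) hinj]
  refine setIntegral_congr_fun hS fun x hx => ?_
  have hi : Function.invFunOn ψ S (ψ x) = x := hinj.leftInvOn_invFunOn hx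
  have h0 : ((|ψ' x| : ℝ) : ℂ) ≠ 0 := by exact_mod_cast abs_ne_zero.2 (hne x hx)
  simp only [hF, hi, Complex.real_smul]
  push_cast
  field_simp

open Set Filter Topology MeasureTheory in
/-- Let `c < d`, `ψ : [c,d] → ℝ` be `C²`, and suppose the set
`{x ∈ [c,d] : ψ′(x) = 0}` has Lebesgue measure zero. Then for every `g ∈ L¹(c,d)`,
`∫_c^d g(x) e^{2iτψ(x)} dx → 0` as `τ → +∞`. -/
theorem stmt_10 (c d : ℝ) (hcd : c < d) (ψ : ℝ → ℝ)
    (hψ : ContDiffOn ℝ 2 ψ (Set.Icc c d))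
    (hcrit : MeasureTheory.volume
        {x ∈ Set.Icc c d | derivWithin ψ (Set.Icc c d) x = 0} = 0)
    (g : ℝ → ℂ) (hg : MeasureTheory.IntegrableOn g (Set.Icc c d)) :
    Filter.Tendsto (fun τ : ℝ =>
        ∫ x in c..d, g x * Complex.exp (2 * Complex.I * τ * ψ x))
      Filter.atTop (nhds 0) := by
  have hdc : ContinuousOn (derivWithin ψ (Icc c d)) (Icc c d) :=
    hψ.continuousOn_derivWithin (uniqueDiffOn_Icc hcd) (by norm_num)
  set ψ' := derivWithin ψ (Icc c d) with hψ'
  have hder : ∀ x ∈ Ioo c d, HasDerivAt ψ (ψ' x) x := fun x hx =>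
    ((hψ.differentiableOn (by norm_num)) x (Ioo_subset_Icc_self hx)).hasDerivWithinAt.hasDerivAt
      (Icc_mem_nhds hx.1 hx.2)
  set U : Set ℝ := Ioo c d ∩ ψ' ⁻¹' {0}ᶜ with hU
  have hUo : IsOpen U :=
    (hdc.mono Ioo_subset_Icc_self).isOpen_inter_preimage isOpen_Ioo isOpen_compl_singleton
  obtain ⟨e, he⟩ := exists_surjective_nat (ℚ × ℚ)
  classical
  set V : ℕ → Set ℝ := fun n =>
    if Ioo ((e n).1 : ℝ) (e n).2 ⊆ U then Ioo ((e n).1 : ℝ) (e n).2 else ∅ with hV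
  have hVU : ∀ n, V n ⊆ U := by
    intro n
    simp only [hV]
    split_ifs with h
    · exact h
    · exact empty_subset _
  have hVm : ∀ n, MeasurableSet (V n) := by
    intro n
    simp only [hV]
    split_ifs
    · exact measurableSet_Ioo
    · exact MeasurableSet.empty
  have hVc : ∀ n, (V n).OrdConnected := by
    intro n
    simp only [hV]
    split_ifs
    · exact ordConnected_Ioo
    · exact ordConnected_empty
  have hVi : ∀ n, InjOn ψ (V n) := by
    intro n
    have key : ∀ x ∈ V n, ∀ y ∈ V n, x < y → ψ x ≠ ψ y := by
      intro x hx y hy hxy heq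
      have hsub : Icc x y ⊆ U := ((hVc n).out hx hy).trans (hVU n)
      obtain ⟨z, hz, hz0⟩ := exists_hasDerivAt_eq_zero hxy
        (fun z hz => (hder z (hsub hz).1).continuousAt.continuousWithinAt) heq
        (fun z hz => hder z (hsub (Ioo_subset_Icc_self hz)).1)
      exact (hsub (Ioo_subset_Icc_self hz)).2 hz0
    intro x hx y hy hxy
    rcases lt_trichotomy x y with h | h | h
    · exact absurd hxy (key x hx y hy h)
    · exact h
    · exact absurd hxy.symm (key y hy x hx h)
  have hVun : ⋃ n, V n = U := by
    apply subset_antisymm (iUnion_subset hVU)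
    intro x hx
    obtain ⟨a, b, hab, hs⟩ := mem_nhds_iff_exists_Ioo_subset.1 (hUo.mem_nhds hx)
    obtain ⟨p, hp1, hp2⟩ := exists_rat_btwn hab.1
    obtain ⟨q, hq1, hq2⟩ := exists_rat_btwn hab.2
    obtain ⟨n, hn⟩ := he (p, q)
    have : Ioo (p : ℝ) q ⊆ U := (Ioo_subset_Ioo hp1.le hq2.le).trans hs
    refine mem_iUnion.2 ⟨n, ?_⟩
    simp only [hV, hn, if_pos this]
    exact ⟨hp2, hq1⟩
  set S := disjointed V with hSdef
  have hSV : ∀ n, S n ⊆ V n := fun n => disjointed_subset V n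
  have hSm : ∀ n, MeasurableSet (S n) := fun n => MeasurableSet.disjointed hVm n
  have hSun : ⋃ n, S n = U := by rw [hSdef, iUnion_disjointed, hVun]
  have hSd : Pairwise (Function.onFun Disjoint S) := disjoint_disjointed V
  have hUI : U ⊆ Icc c d := fun x hx => Ioo_subset_Icc_self hx.1
  have hae : (Ioc c d : Set ℝ) =ᵐ[volume] U := by
    refine Ioo_ae_eq_Ioc.symm.trans ?_
    have : Ioo c d \ U ⊆ {x ∈ Icc c d | ψ' x = 0} := by
      intro x hx
      refine ⟨Ioo_subset_Icc_self hx.1, ?_⟩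
      by_contra h
      exact hx.2 ⟨hx.1, h⟩
    refine EventuallyLE.antisymm ?_ (LE.le.eventuallyLE inter_subset_left)
    exact ae_le_set.2 (measure_mono_null this hcrit)
  have hnorm : ∀ (τ : ℝ) x, ‖g x * Complex.exp (2 * Complex.I * τ * ψ x)‖ = ‖g x‖ := by
    intro τ x
    have : (2 * Complex.I * τ * ψ x : ℂ) = ((2 * τ * ψ x : ℝ) : ℂ) * Complex.I := by
      push_cast; ring
    rw [norm_mul, this, Complex.norm_exp_ofReal_mul_I, mul_one]
  have hint : ∀ τ : ℝ, IntegrableOn (fun x => g x * Complex.exp (2 * Complex.I * τ * ψ x)) U := by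
    intro τ
    have hgU := hg.mono_set hUI
    refine Integrable.mono hgU ?_ (Eventually.of_forall fun x => (hnorm τ x).le)
    refine hgU.aestronglyMeasurable.mul ?_
    refine ContinuousOn.aestronglyMeasurable ?_ hUo.measurableSet
    have : ContinuousOn ψ U := hψ.continuousOn.mono hUI
    have h2 : ContinuousOn (fun x => (ψ x : ℂ)) U := Complex.continuous_ofReal.comp_continuousOn this
    exact Complex.continuous_exp.comp_continuousOn (continuousOn_const.mul h2)
  have hsum : ∀ τ : ℝ, ∫ x in c..d, g x * Complex.exp (2 * Complex.I * τ * ψ x)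
      = ∑' n, ∫ x in S n, g x * Complex.exp (2 * Complex.I * τ * ψ x) := by
    intro τ
    rw [intervalIntegral.integral_of_le hcd.le, setIntegral_congr_set hae, ← hSun]
    exact integral_iUnion hSm hSd (by rw [hSun]; exact hint τ)
  simp_rw [hsum]
  have hbound : Summable fun n => ∫ x in S n, ‖g x‖ :=
    (hasSum_integral_iUnion hSm hSd (by rw [hSun]; exact (hg.mono_set hUI).norm)).summable
  have := tendsto_tsum_of_dominated_convergence (𝓕 := atTop)
    (f := fun (τ : ℝ) n => ∫ x in S n, g x * Complex.exp (2 * Complex.I * τ * ψ x))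
    (g := fun _ => (0 : ℂ)) hbound
    (fun n => aux_piece (S n) (hSm n) ψ ψ' (fun x hx => hder x (hVU n (hSV n hx)).1)
      (fun x hx => (hVU n (hSV n hx)).2) ((hVi n).mono (hSV n)) g)
    (Eventually.of_forall fun τ n => (norm_integral_le_integral_norm _).trans
      (le_of_eq (by simp_rw [hnorm])))
  simpa using this
end
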